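/- Let B = (b_{iℓ}) be an n×2 integer matrix of rank 2 with both column sums equal to zero, with rows b_1, …, b_n ∈ ℤ², and define h_1, h_2 ∈ ℚ[x_1, …, x_n][t] by h_ℓ(t) = ∏_{i : b_{iℓ} > 0} (b_{i1} + b_{i2}·t)^{b_{iℓ}}·x_i^{b_{iℓ}} − ∏_{i : b_{iℓ} < 0} (b_{i1} + b_{i2}·t)^{−b_{iℓ}}·x_i^{−b_{iℓ}}. Let v = (v_1, v_2) ∈ ℤ² be a primitive vector (gcd(v_1, v_2) = 1), let S = {i : b_i is an integer multiple of v}, write b_i = λ_i·v for i ∈ S, assume v is oriented so that Σ_{i ∈ S} λ_i ≥ 0, and set δ_v = Σ_{i ∈ S, λ_i < 0} (−λ_i). Then for ℓ = 1, 2, the polynomial (v_1 + v_2·t)^{δ_v·|v_ℓ|} divides h_ℓ(t) in ℚ[x_1, …, x_n][t]. -/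

import Mathlib

open Polynomial

/-- For an `n × 2` integer matrix `B`, the polynomial
`h_ℓ(t) = ∏_{i : b_{iℓ} > 0} (b_{i1} + b_{i2}·t)^{b_{iℓ}}·x_i^{b_{iℓ}}
        − ∏_{i : b_{iℓ} < 0} (b_{i1} + b_{i2}·t)^{−b_{iℓ}}·x_i^{−b_{iℓ}}`
with coefficients in `ℚ[x_1, …, x_n]`. -/
noncomputable def specH {n : ℕ} (B : Matrix (Fin n) (Fin 2) ℤ) (ℓ : Fin 2) :
    Polynomial (MvPolynomial (Fin n) ℚ) :=
  (∏ i ∈ Finset.univ.filter fun i => 0 < B i ℓ,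
      ((C (MvPolynomial.C ((B i 0 : ℚ))) + C (MvPolynomial.C ((B i 1 : ℚ))) * X) *
        C (MvPolynomial.X i)) ^ (B i ℓ).toNat) -
  (∏ i ∈ Finset.univ.filter fun i => B i ℓ < 0,
      ((C (MvPolynomial.C ((B i 0 : ℚ))) + C (MvPolynomial.C ((B i 1 : ℚ))) * X) *
        C (MvPolynomial.X i)) ^ (-(B i ℓ)).toNat)

/-- If `L ∣ f i` for all `i ∈ S`, then `L ^ (∑ i ∈ S, m i) ∣ ∏ i, f i ^ m i`, where the product
may be restricted to any set of indices containing the support of `m`. -/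
theorem pow_sum_dvd_prod_filter_pow {ι R : Type*} [Fintype ι] [CommMonoid R]
    (p : ι → Prop) [DecidablePred p] (S : Finset ι) (L : R) (f : ι → R) (m : ι → ℕ)
    (hp : ∀ i, ¬ p i → m i = 0) (hL : ∀ i ∈ S, L ∣ f i) :
    L ^ (∑ i ∈ S, m i) ∣ ∏ i ∈ Finset.univ.filter p, f i ^ m i := by
  have hprod : ∏ i ∈ Finset.univ.filter p, f i ^ m i = ∏ i, f i ^ m i := by
    refine Finset.prod_filter_of_ne fun i _ hi => ?_
    by_contra hpi
    exact hi (by rw [hp i hpi, pow_zero])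
  rw [hprod, ← Finset.prod_pow_eq_pow_sum]
  exact (Finset.prod_dvd_prod_of_dvd _ _ fun i hi => pow_dvd_pow_of_dvd (hL i hi) _).trans
    (Finset.prod_dvd_prod_of_subset _ _ _ (Finset.subset_univ S))

/-- If `b i = lam i * w` on `S` and `∑ i ∈ S, lam i ≥ 0`, then the positive parts of the `b i`
sum to at least `|w|` times the sum of the negative parts of the `lam i`. -/
theorem sum_toNat_neg_mul_natAbs_le {ι : Type*} (S : Finset ι) (lam b : ι → ℤ) (w : ℤ)
    (hb : ∀ i ∈ S, b i = lam i * w) (hlam : 0 ≤ ∑ i ∈ S, lam i) :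
    (∑ i ∈ S.filter fun i => lam i < 0, (-(lam i)).toNat) * w.natAbs ≤
      ∑ i ∈ S, (b i).toNat := by
  have hfilter : (∑ i ∈ S.filter fun i => lam i < 0, (-(lam i)).toNat) =
      ∑ i ∈ S, (-(lam i)).toNat :=
    Finset.sum_filter_of_ne fun i _ hi => by omega
  have hle : ∑ i ∈ S, (-(lam i)).toNat ≤ ∑ i ∈ S, (lam i).toNat := by
    zify
    rw [← sub_nonneg, ← Finset.sum_sub_distrib]
    exact hlam.trans_eq (Finset.sum_congr rfl fun i _ => by omega)
  have toNat_mul : ∀ (a : ℤ) (k : ℕ), (a * k).toNat = a.toNat * k := fun a k => by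
    rcases le_total 0 a with ha | ha
    · lift a to ℕ using ha
      norm_cast
    · rw [Int.toNat_of_nonpos ha, zero_mul,
        Int.toNat_of_nonpos (mul_nonpos_of_nonpos_of_nonneg ha (Int.natCast_nonneg k))]
  rw [hfilter]
  obtain ⟨k, rfl | rfl⟩ := Int.eq_nat_or_neg w
  · calc _ ≤ (∑ i ∈ S, (lam i).toNat) * k := by
          rw [Int.natAbs_natCast]
          exact Nat.mul_le_mul_right k hle
      _ = ∑ i ∈ S, (b i).toNat := by
          rw [Finset.sum_mul]
          exact Finset.sum_congr rfl fun i hi => by rw [hb i hi, toNat_mul]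
  · refine le_of_eq ?_
    rw [Int.natAbs_neg, Int.natAbs_natCast, Finset.sum_mul]
    exact Finset.sum_congr rfl fun i hi => by rw [hb i hi, mul_neg, ← neg_mul, toNat_mul]

/-- Let `B = (b_{iℓ})` be an `n × 2` integer matrix of rank `2` with both column sums
zero, and let `h_1, h_2 ∈ ℚ[x_1, …, x_n][t]` be as above.  Let `v = (v_1, v_2) ∈ ℤ²`
be a primitive vector, let `S` be the set of indices `i` such that `b_i` is an integer
multiple `λ_i·v` of `v`, assume `v` is oriented so that `Σ_{i ∈ S} λ_i ≥ 0`, and set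
`δ_v = Σ_{i ∈ S, λ_i < 0} (−λ_i)`.  Then for `ℓ = 1, 2`, the polynomial
`(v_1 + v_2·t)^{δ_v·|v_ℓ|}` divides `h_ℓ(t)` in `ℚ[x_1, …, x_n][t]`. -/
theorem relevant_line_pow_dvd {n : ℕ} (B : Matrix (Fin n) (Fin 2) ℤ)
    (hrank : B.rank = 2) (hsum : ∀ ℓ : Fin 2, ∑ i, B i ℓ = 0)
    (v : ℤ × ℤ) (hv : Int.gcd v.1 v.2 = 1)
    (S : Finset (Fin n)) (lam : Fin n → ℤ)
    (hS : ∀ i, i ∈ S ↔ ∃ k : ℤ, B i 0 = k * v.1 ∧ B i 1 = k * v.2)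
    (hlam : ∀ i ∈ S, B i 0 = lam i * v.1 ∧ B i 1 = lam i * v.2)
    (horient : 0 ≤ ∑ i ∈ S, lam i) :
    ∀ ℓ : Fin 2,
      (C (MvPolynomial.C ((v.1 : ℚ))) + C (MvPolynomial.C ((v.2 : ℚ))) * X) ^
          ((∑ i ∈ S.filter fun i => lam i < 0, (-(lam i)).toNat) *
            (if ℓ = 0 then v.1.natAbs else v.2.natAbs)) ∣
        specH B ℓ := by
  intro ℓ
  set w : ℤ := if ℓ = 0 then v.1 else v.2 with hw
  have hnatAbs : (if ℓ = 0 then v.1.natAbs else v.2.natAbs) = w.natAbs := by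
    rw [hw, apply_ite Int.natAbs]
  have hB : ∀ i ∈ S, B i ℓ = lam i * w := fun i hi => by
    fin_cases ℓ
    · exact (hlam i hi).1
    · exact (hlam i hi).2
  have hdvd : ∀ i ∈ S,
      (C (MvPolynomial.C ((v.1 : ℚ))) + C (MvPolynomial.C ((v.2 : ℚ))) * X :
        Polynomial (MvPolynomial (Fin n) ℚ)) ∣
      (C (MvPolynomial.C ((B i 0 : ℚ))) + C (MvPolynomial.C ((B i 1 : ℚ))) * X) *
        C (MvPolynomial.X i) := fun i hi => by
    refine Dvd.dvd.mul_right ⟨C (MvPolynomial.C (lam i : ℚ)), ?_⟩ _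
    rw [(hlam i hi).1, (hlam i hi).2]
    push_cast
    simp only [map_mul]
    ring
  rw [hnatAbs, specH]
  refine dvd_sub ?_ ?_
  · exact (pow_dvd_pow _ (sum_toNat_neg_mul_natAbs_le S lam _ w hB horient)).trans
      (pow_sum_dvd_prod_filter_pow _ S _ _ _ (fun i hi => by omega) hdvd)
  · rw [← Int.natAbs_neg w]
    exact (pow_dvd_pow _ (sum_toNat_neg_mul_natAbs_le S lam (fun i => -(B i ℓ)) (-w)
        (fun i hi => by rw [hB i hi, mul_neg]) horient)).trans
      (pow_sum_dvd_prod_filter_pow _ S _ _ _ (fun i hi => by omega) hdvd)
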